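/- arXiv:1703.02276 — 4 statements merged into one kernel-verified Lean document; each statement's English description precedes it below -/
import Mathlib

section
/- Let μ be a finite positive Borel measure on ℝ and let f : ℝ → ℝ be twice differentiable with f(0) = 0, f′(0) = 0, and f″(t) = −∫_ℝ cos(tν) dμ(ν) for every t ∈ ℝ. Then for every t ∈ ℝ, f(t) = −(t²/2)·μ({0}) + ∫_{ℝ∖{0}} (cos(tν) − 1)·ν^{−2} dμ(ν). -/
open MeasureTheory

/-- Two differentiable real functions with the same derivative that agree at `0` are equal. -/
lemma eq_of_hasDerivAt_eq_of_eq_zero {g h d : ℝ → ℝ} (hg : ∀ t, HasDerivAt g (d t) t)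
    (hh : ∀ t, HasDerivAt h (d t) t) (h0 : g 0 = h 0) (t : ℝ) : g t = h t := by
  have hd : ∀ x, HasDerivAt (fun y => g y - h y) 0 x := fun x => by
    simpa using (hg x).fun_sub (hh x)
  have hc := is_const_of_deriv_eq_zero (fun x => (hd x).differentiableAt)
    (fun x => (hd x).deriv) t 0
  simp only [h0, sub_self] at hc
  linarith

lemma abs_sin_mul_div_le (t x : ℝ) : |Real.sin (t * x) / x| ≤ |t| := by
  rcases eq_or_ne x 0 with rfl | hx
  · simp
  · rw [abs_div, div_le_iff₀ (abs_pos.2 hx), ← abs_mul]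
    exact Real.abs_sin_le_abs

lemma abs_cos_mul_sub_one_div_sq_le (t x : ℝ) :
    |(Real.cos (t * x) - 1) / x ^ 2| ≤ t ^ 2 / 2 := by
  rcases eq_or_ne x 0 with rfl | hx
  · simp; positivity
  · have hx2 : 0 < x ^ 2 := by positivity
    rw [abs_div, abs_of_pos hx2, div_le_iff₀ hx2, abs_le]
    have h1 := Real.one_sub_sq_div_two_le_cos (x := t * x)
    have h2 := Real.cos_le_one (t * x)
    constructor <;> nlinarith [mul_nonneg (sq_nonneg t) hx2.le]

/-- Differentiating `∫ (cos (t x) - 1) x⁻² dρ(x)` under the integral sign. -/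
lemma hasDerivAt_integral_cos_sub_one_div_sq (ρ : Measure ℝ) [IsFiniteMeasure ρ] (t : ℝ) :
    HasDerivAt (fun s => ∫ x, (Real.cos (s * x) - 1) / x ^ 2 ∂ρ)
      (∫ x, -(Real.sin (t * x) / x) ∂ρ) t := by
  have hmeas : ∀ s : ℝ, AEStronglyMeasurable (fun x => (Real.cos (s * x) - 1) / x ^ 2) ρ :=
    fun s => Measurable.aestronglyMeasurable (by fun_prop)
  refine (hasDerivAt_integral_of_dominated_loc_of_deriv_le
    (F := fun s x => (Real.cos (s * x) - 1) / x ^ 2)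
    (F' := fun s x => -(Real.sin (s * x) / x)) (bound := fun _ => |t| + 1)
    (Metric.ball_mem_nhds t one_pos) (.of_forall hmeas)
    (.of_bound (hmeas t) (t ^ 2 / 2) (.of_forall (abs_cos_mul_sub_one_div_sq_le t)))
    (Measurable.aestronglyMeasurable (by fun_prop)) (.of_forall fun x s hs => ?_)
    (integrable_const _) (.of_forall fun x s _ => ?_)).2
  · rw [Real.norm_eq_abs, abs_neg]
    rw [Metric.mem_ball, Real.dist_eq] at hs
    linarith [abs_sin_mul_div_le s x, abs_sub_abs_le_abs_sub s t]
  · rcases eq_or_ne x 0 with rfl | hx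
    · simpa using hasDerivAt_const s (0 : ℝ)
    · refine (((((hasDerivAt_id' s).mul_const x).cos).sub_const 1).div_const (x ^ 2)).congr_deriv ?_
      field_simp

/-- Differentiating `∫ -sin (t x) x⁻¹ dρ(x)` under the integral sign, when `ρ` has no atom
at `0`. -/
lemma hasDerivAt_integral_neg_sin_div (ρ : Measure ℝ) [IsFiniteMeasure ρ]
    (hρ : ∀ᵐ x ∂ρ, x ≠ 0) (t : ℝ) :
    HasDerivAt (fun s => ∫ x, -(Real.sin (s * x) / x) ∂ρ)
      (∫ x, -Real.cos (t * x) ∂ρ) t := by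
  have hmeas : ∀ s : ℝ, AEStronglyMeasurable (fun x => -(Real.sin (s * x) / x)) ρ :=
    fun s => Measurable.aestronglyMeasurable (by fun_prop)
  refine (hasDerivAt_integral_of_dominated_loc_of_deriv_le
    (F := fun s x => -(Real.sin (s * x) / x))
    (F' := fun s x => -Real.cos (s * x)) (bound := fun _ => 1)
    Filter.univ_mem (.of_forall hmeas)
    (.of_bound (hmeas t) |t| (.of_forall fun x => ?_))
    (Measurable.aestronglyMeasurable (by fun_prop)) (.of_forall fun x s _ => ?_)
    (integrable_const _) (hρ.mono fun x hx s _ => ?_)).2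
  · rw [norm_neg]
    exact abs_sin_mul_div_le t x
  · rw [norm_neg]
    exact Real.abs_cos_le_one _
  · refine ((((hasDerivAt_id' s).mul_const x).sin).div_const x).fun_neg.congr_deriv ?_
    field_simp

lemma integral_cos_mul_eq_add_compl (μ : Measure ℝ) [IsFiniteMeasure μ] (t : ℝ) :
    ∫ x, Real.cos (t * x) ∂μ
      = (μ {0}).toReal + ∫ x in ({0}ᶜ : Set ℝ), Real.cos (t * x) ∂μ := by
  have hint : Integrable (fun x => Real.cos (t * x)) μ :=
    .of_bound (Measurable.aestronglyMeasurable (by fun_prop)) 1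
      (.of_forall fun x => Real.abs_cos_le_one _)
  rw [← integral_add_compl (measurableSet_singleton (0 : ℝ)) hint, integral_singleton]
  simp [Measure.real]

/-- If `f : ℝ → ℝ` is twice differentiable with `f 0 = 0`, `f' 0 = 0` and second derivative
`f'' t = -∫ cos (t ν) dμ(ν)` for a finite positive Borel measure `μ`, then
`f t = -(t²/2) μ({0}) + ∫_{ℝ∖{0}} (cos (t ν) - 1) ν⁻² dμ(ν)`. -/
theorem levy_khintchine_from_second_derivative
    (μ : Measure ℝ) [IsFiniteMeasure μ]
    (f f' : ℝ → ℝ)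
    (hf : ∀ t : ℝ, HasDerivAt f (f' t) t)
    (hf'' : ∀ t : ℝ, HasDerivAt f' (-∫ ν, Real.cos (t * ν) ∂μ) t)
    (hf0 : f 0 = 0) (hf'0 : f' 0 = 0) :
    ∀ t : ℝ, f t = -(t ^ 2 / 2) * (μ {0}).toReal
      + ∫ ν in ({0}ᶜ : Set ℝ), (Real.cos (t * ν) - 1) / ν ^ 2 ∂μ := by
  have hne : ∀ᵐ x ∂μ.restrict ({0}ᶜ : Set ℝ), x ≠ 0 :=
    ae_restrict_mem (measurableSet_singleton (0 : ℝ)).compl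
  have hf'_eq : ∀ t, f' t = -t * (μ {0}).toReal
      + ∫ ν in ({0}ᶜ : Set ℝ), -(Real.sin (t * ν) / ν) ∂μ := by
    refine eq_of_hasDerivAt_eq_of_eq_zero hf'' (fun t => ?_) (by simp [hf'0])
    refine (((hasDerivAt_id' t).fun_neg.mul_const (μ {0}).toReal).fun_add
      (hasDerivAt_integral_neg_sin_div _ hne t)).congr_deriv ?_
    rw [integral_cos_mul_eq_add_compl, integral_neg]
    ring
  refine eq_of_hasDerivAt_eq_of_eq_zero hf (fun t => ?_) (by simp [hf0])
  refine (((((hasDerivAt_pow 2 t).div_const 2).fun_neg).mul_const (μ {0}).toReal).fun_add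
    (hasDerivAt_integral_cos_sub_one_div_sq (μ.restrict ({0}ᶜ : Set ℝ)) t)).congr_deriv ?_
  rw [hf'_eq]
  norm_num
end

section
/- Let μ be a finite positive Borel measure on ℝ. Then for every t ∈ ℝ, ∫₀^t ∫₀^s (∫_ℝ cos(αν) dμ(ν)) dα ds = (t²/2)·μ({0}) + ∫_{ℝ∖{0}} (1 − cos(tν))·ν^{−2} dμ(ν), where the outer integrals are iterated Riemann (or Bochner) integrals over the real intervals [0,s] and [0,t]. -/
open MeasureTheory

theorem integrable_restrict_uIoc_prod {μ : Measure ℝ} [IsFiniteMeasure μ]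
    {f : ℝ → ℝ → ℝ} (hf : Continuous (Function.uncurry f)) {a b C : ℝ}
    (hC : ∀ x ∈ Set.uIoc a b, ∀ ν, |f x ν| ≤ C) :
    Integrable (Function.uncurry f) ((volume.restrict (Set.uIoc a b)).prod μ) := by
  have hfin : IsFiniteMeasure (volume.restrict (Set.uIoc a b)) := by
    unfold Set.uIoc; infer_instance
  refine Integrable.of_bound hf.aestronglyMeasurable C ?_
  have h : ∀ᵐ x ∂(volume.restrict (Set.uIoc a b)), x ∈ Set.uIoc a b :=
    ae_restrict_mem measurableSet_uIoc
  filter_upwards [Measure.quasiMeasurePreserving_fst.ae h] with p hp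
  exact hC p.1 hp p.2

theorem intervalIntegral_cos_mul (s ν : ℝ) :
    ∫ α in (0 : ℝ)..s, Real.cos (α * ν) = s * Real.sinc (s * ν) := by
  rcases eq_or_ne ν 0 with rfl | hν
  · simp
  rcases eq_or_ne s 0 with rfl | hs
  · simp
  rw [intervalIntegral.integral_comp_mul_right _ hν, integral_cos,
    Real.sinc_of_ne_zero (mul_ne_zero hs hν)]
  simp
  field_simp

theorem intervalIntegral_mul_sinc_mul {ν : ℝ} (hν : ν ≠ 0) (t : ℝ) :
    ∫ s in (0 : ℝ)..t, s * Real.sinc (s * ν) = (1 - Real.cos (t * ν)) / ν ^ 2 := by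
  have h (s : ℝ) : s * Real.sinc (s * ν) = Real.sin (s * ν) / ν := by
    rcases eq_or_ne s 0 with rfl | hs
    · simp
    rw [Real.sinc_of_ne_zero (mul_ne_zero hs hν)]
    field_simp
  simp_rw [h]
  rw [intervalIntegral.integral_div, intervalIntegral.integral_comp_mul_right _ hν, integral_sin]
  simp
  field_simp

/-- For a finite positive Borel measure `μ` on `ℝ`, the iterated integral
`∫₀^t ∫₀^s (∫ cos (α ν) dμ(ν)) dα ds` equals
`(t²/2) μ({0}) + ∫_{ℝ∖{0}} (1 - cos (t ν)) ν⁻² dμ(ν)`. -/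
theorem iterated_integral_cos_transform
    (μ : Measure ℝ) [IsFiniteMeasure μ] :
    ∀ t : ℝ,
      (∫ s in (0 : ℝ)..t, ∫ α in (0 : ℝ)..s, ∫ ν, Real.cos (α * ν) ∂μ)
        = t ^ 2 / 2 * (μ {0}).toReal
          + ∫ ν in ({0}ᶜ : Set ℝ), (1 - Real.cos (t * ν)) / ν ^ 2 ∂μ := by
  intro t
  have inner (s : ℝ) : ∫ α in (0 : ℝ)..s, ∫ ν, Real.cos (α * ν) ∂μ
      = ∫ ν, s * Real.sinc (s * ν) ∂μ := by
    rw [intervalIntegral_integral_swap (integrable_restrict_uIoc_prod (C := 1)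
      (by unfold Function.uncurry; fun_prop) fun x _ ν ↦ Real.abs_cos_le_one _)]
    simp_rw [intervalIntegral_cos_mul]
  have hk : Integrable (Function.uncurry fun s ν : ℝ ↦ s * Real.sinc (s * ν))
      ((volume.restrict (Set.uIoc 0 t)).prod μ) := by
    refine integrable_restrict_uIoc_prod (C := |t|) ?_ fun s hs ν ↦ ?_
    · exact continuous_fst.mul (Real.continuous_sinc.comp (continuous_fst.mul continuous_snd))
    · have hst : |s| ≤ |t| := by
        simpa using Set.abs_sub_left_of_mem_uIcc (Set.uIoc_subset_uIcc hs)
      rw [abs_mul]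
      exact (mul_le_of_le_one_right (abs_nonneg _) (Real.abs_sinc_le_one _)).trans hst
  have hK : Integrable (fun ν ↦ ∫ s in (0 : ℝ)..t, s * Real.sinc (s * ν)) μ := by
    simp_rw [intervalIntegral.intervalIntegral_eq_integral_uIoc]
    exact hk.integral_prod_right.smul (if (0 : ℝ) ≤ t then (1 : ℝ) else -1)
  simp_rw [inner]
  rw [intervalIntegral_integral_swap hk,
    ← integral_add_compl (measurableSet_singleton (0 : ℝ)) hK, integral_singleton]
  congr 1
  · simp [measureReal_def, mul_comm]
  · exact setIntegral_congr_fun (measurableSet_singleton _).compl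
      fun ν hν ↦ intervalIntegral_mul_sinc_mul hν t
end

section
/- Let μ be a finite positive Borel measure on ℝ with μ({0}) = 0 and ∫_{ℝ∖{0}} ν^{−2} dμ(ν) < ∞, and define g : ℝ → ℝ by g(t) := ∫_{ℝ∖{0}} (cos(tν) − 1)·ν^{−2} dμ(ν). Then the Cesàro means of g converge: lim_{t→∞} (1/t) ∫₀^t g(s) ds = −∫_{ℝ∖{0}} ν^{−2} dμ(ν). -/
open MeasureTheory Filter

theorem Real.tendsto_sinc_atTop : Tendsto Real.sinc atTop (nhds 0) := by
  refine squeeze_zero_norm' ?_ tendsto_inv_atTop_zero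
  filter_upwards [eventually_gt_atTop 0] with x hx
  rw [Real.sinc_of_ne_zero hx.ne', norm_div, Real.norm_eq_abs, Real.norm_of_nonneg hx.le,
    ← one_div]
  gcongr
  exact Real.abs_sin_le_one x

theorem Real.tendsto_sinc_mul_atTop {ν : ℝ} (hν : ν ≠ 0) :
    Tendsto (fun t : ℝ => Real.sinc (t * ν)) atTop (nhds 0) := by
  rcases hν.lt_or_gt with h | h
  · refine (Real.tendsto_sinc_atTop.comp (tendsto_id.atTop_mul_const (neg_pos.2 h))).congr ?_
    intro t
    simp [Real.sinc_neg]
  · exact Real.tendsto_sinc_atTop.comp (tendsto_id.atTop_mul_const h)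

theorem average_cos_mul_sub_one {t ν : ℝ} (ht : t ≠ 0) (hν : ν ≠ 0) :
    t⁻¹ * ∫ s in (0 : ℝ)..t, (Real.cos (s * ν) - 1) / ν ^ 2 =
      (Real.sinc (t * ν) - 1) * (ν ^ 2)⁻¹ := by
  rw [intervalIntegral.integral_div, intervalIntegral.integral_sub
    (Continuous.intervalIntegrable (by fun_prop) _ _) (by simp),
    intervalIntegral.integral_comp_mul_right _ hν, Real.sinc_of_ne_zero (mul_ne_zero ht hν)]
  simp
  field_simp

theorem integrable_cos_mul_sub_one_div_sq_prod {μ : Measure ℝ} [SFinite μ]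
    (hint : Integrable (fun ν : ℝ => (ν ^ 2)⁻¹) μ) (κ : Measure ℝ) [IsFiniteMeasure κ] :
    Integrable (Function.uncurry fun s ν : ℝ => (Real.cos (s * ν) - 1) / ν ^ 2) (κ.prod μ) := by
  refine ((hint.comp_snd κ).const_mul 2).mono
    (Measurable.aestronglyMeasurable (by unfold Function.uncurry; fun_prop))
    (ae_of_all _ fun p => ?_)
  have h : |Real.cos (p.1 * p.2) - 1| ≤ 2 := by
    rw [abs_le]
    constructor <;> linarith [Real.cos_le_one (p.1 * p.2), Real.neg_one_le_cos (p.1 * p.2)]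
  simp only [Function.uncurry, div_eq_mul_inv, norm_mul, Real.norm_eq_abs, abs_two]
  gcongr

/-- Cesàro means of `g t = ∫_{ℝ∖{0}} (cos (t ν) - 1) ν⁻² dμ(ν)` converge to
`-∫_{ℝ∖{0}} ν⁻² dμ(ν)`, for a finite positive Borel measure `μ` with `μ({0}) = 0` and
`∫_{ℝ∖{0}} ν⁻² dμ(ν) < ∞`. -/
theorem cesaro_mean_of_levy_exponent
    (μ : Measure ℝ) [IsFiniteMeasure μ]
    (h0 : μ {0} = 0)
    (hint : Integrable (fun ν : ℝ => (ν ^ 2)⁻¹) (μ.restrict ({0}ᶜ : Set ℝ))) :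
    Tendsto
      (fun t : ℝ => t⁻¹ *
        ∫ s in (0 : ℝ)..t, ∫ ν in ({0}ᶜ : Set ℝ), (Real.cos (s * ν) - 1) / ν ^ 2 ∂μ)
      atTop
      (nhds (-∫ ν in ({0}ᶜ : Set ℝ), (ν ^ 2)⁻¹ ∂μ)) := by
  have hne : ∀ᵐ ν ∂μ.restrict ({0}ᶜ : Set ℝ), ν ≠ 0 :=
    ae_restrict_mem (measurableSet_singleton (0 : ℝ)).compl
  have hlim : Tendsto
      (fun t : ℝ => ∫ ν in ({0}ᶜ : Set ℝ), (Real.sinc (t * ν) - 1) * (ν ^ 2)⁻¹ ∂μ)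
      atTop (nhds (∫ ν in ({0}ᶜ : Set ℝ), -(ν ^ 2)⁻¹ ∂μ)) := by
    refine tendsto_integral_filter_of_dominated_convergence (fun ν => 2 * (ν ^ 2)⁻¹)
      (.of_forall fun t => ?_) (.of_forall fun t => ae_of_all _ fun ν => ?_)
      (hint.const_mul 2) ?_
    · have := Real.continuous_sinc.measurable
      exact Measurable.aestronglyMeasurable (by fun_prop)
    · have h : |Real.sinc (t * ν) - 1| ≤ 2 := by
        rw [abs_le]
        constructor <;> linarith [Real.sinc_le_one (t * ν), Real.neg_one_le_sinc (t * ν)]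
      rw [norm_mul, Real.norm_eq_abs, Real.norm_of_nonneg (by positivity)]
      gcongr
    · filter_upwards [hne] with ν hν
      simpa using ((Real.tendsto_sinc_mul_atTop hν).sub_const 1).mul_const (ν ^ 2)⁻¹
  rw [← integral_neg]
  refine hlim.congr' ?_
  filter_upwards [eventually_ne_atTop 0] with t ht
  have : IsFiniteMeasure (volume.restrict (Set.uIoc 0 t)) :=
    inferInstanceAs (IsFiniteMeasure (volume.restrict (Set.Ioc _ _)))
  rw [intervalIntegral_integral_swap (integrable_cos_mul_sub_one_div_sq_prod hint _),
    ← integral_const_mul]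
  refine integral_congr_ae ?_
  filter_upwards [hne] with ν hν
  exact (average_cos_mul_sub_one ht hν).symm
end

section
/- Let d ≥ 1 and ε > 0, and define F : [0,∞) → (0,∞) by F(r) := (1+r)^{−(d+ε)}. Then: (a) Σ_{x∈ℤ^d} F(‖x‖) < ∞, where ‖·‖ is the Euclidean norm on ℝ^d; and (b) F has a finite convolution constant, i.e. there is a constant D < ∞ such that for all x, y ∈ ℤ^d, Σ_{z∈ℤ^d} F(‖x−z‖)·F(‖z−y‖) ≤ D · F(‖x−y‖). -/
/-- Euclidean norm of a lattice point of `ℤᵈ`, viewed inside `ℝᵈ`. -/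
noncomputable def znorm {d : ℕ} (x : Fin d → ℤ) : ℝ :=
  Real.sqrt (∑ i, ((x i : ℝ)) ^ 2)

theorem znorm_eq_norm {d : ℕ} (x : Fin d → ℤ) :
    znorm x = ‖(WithLp.toLp 2 (fun i => (x i : ℝ)) : EuclideanSpace ℝ (Fin d))‖ := by
  simp [znorm, EuclideanSpace.norm_eq]

theorem znorm_nonneg {d : ℕ} (x : Fin d → ℤ) : 0 ≤ znorm x :=
  Real.sqrt_nonneg _

theorem znorm_add_le {d : ℕ} (x y : Fin d → ℤ) : znorm (x + y) ≤ znorm x + znorm y := by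
  simp only [znorm_eq_norm]
  refine le_trans (le_of_eq ?_) (norm_add_le _ _)
  congr 1
  ext i
  simp

theorem one_le_znorm {d : ℕ} {x : Fin d → ℤ} (hx : x ≠ 0) : 1 ≤ znorm x := by
  obtain ⟨i, hi⟩ := Function.ne_iff.mp hx
  have hone : (1 : ℝ) ≤ (x i : ℝ) ^ 2 := by
    exact_mod_cast Int.add_one_le_iff.mpr (sq_pos_of_ne_zero (a := x i) (by simpa using hi))
  rw [znorm, Real.one_le_sqrt]
  exact hone.trans (Finset.single_le_sum (f := fun j => (x j : ℝ) ^ 2)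
    (fun _ _ => sq_nonneg _) (Finset.mem_univ i))

theorem summable_znorm_rpow {d : ℕ} {r : ℝ} (hr : r < -(d : ℝ)) :
    Summable (fun x : Fin d → ℤ => znorm x ^ r) := by
  let b := (EuclideanSpace.basisFun (Fin d) ℝ).toBasis
  let L : Submodule ℤ (EuclideanSpace ℝ (Fin d)) := Submodule.span ℤ (Set.range b)
  have hrank : Module.finrank ℤ L = d := by
    rw [ZLattice.rank ℝ L]
    simp
  have hmem (x : Fin d → ℤ) : WithLp.toLp 2 (fun i => (x i : ℝ)) ∈ L := by
    rw [Module.Basis.mem_span_iff_repr_mem]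
    intro i
    exact ⟨x i, by simp [b]⟩
  let e : (Fin d → ℤ) → L := fun x => ⟨_, hmem x⟩
  have he : Function.Injective e := by
    intro x y hxy
    ext i
    have h := congrArg (fun v : L => (v : EuclideanSpace ℝ (Fin d)) i) hxy
    simpa [e] using h
  have hs := (ZLattice.summable_norm_rpow L r (by rwa [hrank])).comp_injective he
  refine hs.congr fun x => ?_
  rw [znorm_eq_norm]
  rfl

theorem summable_one_add_znorm_rpow {d : ℕ} {r : ℝ} (hr : r < -(d : ℝ)) :
    Summable (fun x : Fin d → ℤ => (1 + znorm x) ^ r) := by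
  refine (summable_znorm_rpow hr).of_norm_bounded_eventually ?_
  refine (Set.finite_singleton (0 : Fin d → ℤ)).subset fun x hx => ?_
  by_contra hne
  refine hx ?_
  have h := one_le_znorm hne
  change ‖(1 + znorm x) ^ r‖ ≤ znorm x ^ r
  rw [Real.norm_of_nonneg (by positivity)]
  exact Real.rpow_le_rpow_of_nonpos (by linarith) (by linarith)
    (by linarith [d.cast_nonneg (α := ℝ)])

theorem rpow_neg_mul_rpow_neg_le {a b c p : ℝ} (ha : 0 < a) (hb : 0 < b) (hc : 0 < c)
    (hp : 0 ≤ p) (h : c ≤ a + b) :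
    a ^ (-p) * b ^ (-p) ≤ 2 ^ p * c ^ (-p) * (a ^ (-p) + b ^ (-p)) := by
  wlog hab : a ≤ b generalizing a b
  · rw [mul_comm (a ^ (-p)), add_comm (a ^ (-p))]
    exact this hb ha (by linarith) (by linarith)
  have hbc : b ^ (-p) ≤ 2 ^ p * c ^ (-p) := by
    calc b ^ (-p) ≤ (c / 2) ^ (-p) :=
          Real.rpow_le_rpow_of_nonpos (by positivity) (by linarith) (by linarith)
      _ = 2 ^ p * c ^ (-p) := by
          rw [Real.div_rpow hc.le zero_le_two, Real.rpow_neg zero_le_two, div_inv_eq_mul,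
            mul_comm]
  calc a ^ (-p) * b ^ (-p) = b ^ (-p) * a ^ (-p) := mul_comm _ _
    _ ≤ 2 ^ p * c ^ (-p) * (a ^ (-p) + b ^ (-p)) := by
        gcongr
        exact le_add_of_nonneg_right (by positivity)

/-- The polynomially decaying function `F(r) = (1+r)^{-(d+ε)}` is summable over `ℤᵈ`
and has a finite convolution constant. -/
theorem polynomial_decay_summable_and_convolution
    (d : ℕ) (hd : 1 ≤ d) (ε : ℝ) (hε : 0 < ε) :
    Summable (fun x : Fin d → ℤ => (1 + znorm x) ^ (-((d : ℝ) + ε))) ∧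
    ∃ D : ℝ, ∀ x y : Fin d → ℤ,
      (∑' z : Fin d → ℤ,
          (1 + znorm (x - z)) ^ (-((d : ℝ) + ε)) *
            (1 + znorm (z - y)) ^ (-((d : ℝ) + ε)))
        ≤ D * (1 + znorm (x - y)) ^ (-((d : ℝ) + ε)) := by
  have hp : 0 ≤ (d : ℝ) + ε := by positivity
  have hsum := summable_one_add_znorm_rpow (d := d) (r := -((d : ℝ) + ε)) (by linarith)
  refine ⟨hsum, 2 ^ ((d : ℝ) + ε) *
    (2 * ∑' z : Fin d → ℤ, (1 + znorm z) ^ (-((d : ℝ) + ε))), fun x y => ?_⟩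
  have hpos (z : Fin d → ℤ) : 0 < 1 + znorm z := by linarith [znorm_nonneg z]
  have hx := (Equiv.subLeft x).summable_iff.mpr hsum
  have hy := (Equiv.subRight y).summable_iff.mpr hsum
  have htx := (Equiv.subLeft x).tsum_eq fun z => (1 + znorm z) ^ (-((d : ℝ) + ε))
  have hty := (Equiv.subRight y).tsum_eq fun z => (1 + znorm z) ^ (-((d : ℝ) + ε))
  simp only [Function.comp_def, Equiv.subLeft_apply, Equiv.subRight_apply] at hx hy htx hty
  have hle (z : Fin d → ℤ) :=
    rpow_neg_mul_rpow_neg_le (hpos (x - z)) (hpos (z - y)) (hpos (x - y)) hp (by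
      have h := znorm_add_le (x - z) (z - y)
      rw [sub_add_sub_cancel] at h
      linarith)
  have hbound := (hx.add hy).mul_left
    (2 ^ ((d : ℝ) + ε) * (1 + znorm (x - y)) ^ (-((d : ℝ) + ε)))
  have hconv := Summable.of_nonneg_of_le
    (fun z => mul_nonneg (Real.rpow_nonneg (hpos (x - z)).le _)
      (Real.rpow_nonneg (hpos (z - y)).le _)) hle hbound
  refine (hconv.tsum_le_tsum hle hbound).trans (le_of_eq ?_)
  rw [tsum_mul_left, hx.tsum_add hy, htx, hty]
  ring
end
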